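/- Let k = (9/8)^{1/5} and define τ : ℝ² → ℝ² by τ(u,v) = ( (1/3)k²(eᵘ + eᵛ)², k(eᵘ − eᵛ) ). Let G(x,y) = [[0, (x+y²)/2], [(x+y²)/2, 0]] be the matrix of the metric (x + y²)dxdy, and let G'(u,v) = [[(e^{3u} + e^{3v})e^{2u}, 0], [0, −(e^{3u} + e^{3v})e^{2v}]] be the matrix of the metric (e^{3u} + e^{3v})(e^{2u}du² − e^{2v}dv²). Then for every (u,v) ∈ ℝ² one has Dτ(u,v)ᵀ · G(τ(u,v)) · Dτ(u,v) = G'(u,v); moreover the Jacobian determinant of τ is nonzero at every point of ℝ², so τ is a local isometry from the metric (e^{3u} + e^{3v})(e^{2u}du² − e^{2v}dv²) onto patches of the metric (x + y²)dxdy with x > 0. -/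

import Mathlib

open Real Matrix

/-- Partial derivative in direction `i` (0 = x, 1 = y) of a function on `ℝ × ℝ`. -/
noncomputable def pd (i : Fin 2) (f : ℝ × ℝ → ℝ) (p : ℝ × ℝ) : ℝ :=
  fderiv ℝ f p (if i = 0 then (1, 0) else (0, 1))

/-- Jacobian matrix of a map `τ : ℝ × ℝ → ℝ × ℝ`. -/
noncomputable def jac (τ : ℝ × ℝ → ℝ × ℝ) (p : ℝ × ℝ) : Matrix (Fin 2) (Fin 2) ℝ :=
  Matrix.of fun i j => pd j (fun q => if i = 0 then (τ q).1 else (τ q).2) p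

/-- The constant `k = (9/8)^(1/5)`. -/
noncomputable def kConst : ℝ := ((9 : ℝ) / 8) ^ ((1 : ℝ) / 5)

/-- `τ(u,v) = ((1/3)k²(eᵘ + eᵛ)², k(eᵘ − eᵛ))`. -/
noncomputable def τ₄ (p : ℝ × ℝ) : ℝ × ℝ :=
  ((1 / 3) * kConst ^ 2 * (Real.exp p.1 + Real.exp p.2) ^ 2,
    kConst * (Real.exp p.1 - Real.exp p.2))

/-- Matrix of the metric `(x + y²) dxdy`. -/
noncomputable def Gtarget (p : ℝ × ℝ) : Matrix (Fin 2) (Fin 2) ℝ :=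
  !![0, (p.1 + p.2 ^ 2) / 2; (p.1 + p.2 ^ 2) / 2, 0]

/-- Matrix of the metric `(e^{3u} + e^{3v})(e^{2u} du² − e^{2v} dv²)`. -/
noncomputable def Gsource₄ (p : ℝ × ℝ) : Matrix (Fin 2) (Fin 2) ℝ :=
  !![(Real.exp (3 * p.1) + Real.exp (3 * p.2)) * Real.exp (2 * p.1), 0;
     0, -((Real.exp (3 * p.1) + Real.exp (3 * p.2)) * Real.exp (2 * p.2))]

theorem kConst_pos : 0 < kConst := by unfold kConst; positivity

theorem kConst_pow : kConst ^ 5 = 9 / 8 := by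
  unfold kConst
  rw [← Real.rpow_natCast, ← Real.rpow_mul (by norm_num)]
  norm_num

theorem jac_τ₄ (p : ℝ × ℝ) : jac τ₄ p =
    !![2 / 3 * kConst ^ 2 * (Real.exp p.1 + Real.exp p.2) * Real.exp p.1,
       2 / 3 * kConst ^ 2 * (Real.exp p.1 + Real.exp p.2) * Real.exp p.2;
       kConst * Real.exp p.1, -(kConst * Real.exp p.2)] := by
  have h1 : HasFDerivAt (fun q : ℝ × ℝ => Real.exp q.1)
      (Real.exp p.1 • ContinuousLinearMap.fst ℝ ℝ ℝ) p := hasFDerivAt_fst.exp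
  have h2 : HasFDerivAt (fun q : ℝ × ℝ => Real.exp q.2)
      (Real.exp p.2 • ContinuousLinearMap.snd ℝ ℝ ℝ) p := hasFDerivAt_snd.exp
  have hx := (HasFDerivAt.pow (h1.fun_add h2) 2).const_mul (1 / 3 * kConst ^ 2)
  have hy := (h1.fun_sub h2).const_mul kConst
  ext i j
  fin_cases i <;> fin_cases j <;> simp [jac, pd, τ₄] <;>
    first
    | (have := hx.fderiv; simp at this; rw [this]; simp; ring)
    | (rw [hy.fderiv]; simp)

/-- `τ₄` pulls back the metric `(x + y²)dxdy` to `(e^{3u} + e^{3v})(e^{2u}du² − e^{2v}dv²)`,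
has everywhere nonzero Jacobian determinant, and maps into `{x > 0}`:
it is a local isometry between the two metrics. -/
theorem stmt_4 :
    (∀ p : ℝ × ℝ, (jac τ₄ p)ᵀ * Gtarget (τ₄ p) * jac τ₄ p = Gsource₄ p) ∧
    (∀ p : ℝ × ℝ, (jac τ₄ p).det ≠ 0) ∧
    (∀ p : ℝ × ℝ, 0 < (τ₄ p).1) := by
  have hk := kConst_pos
  have hk5 := kConst_pow
  refine ⟨fun p => ?_, fun p => ?_, fun p => ?_⟩
  · have e3 : ∀ x : ℝ, Real.exp (3 * x) = Real.exp x ^ 3 := fun x => by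
      rw [← Real.exp_nat_mul]; norm_num
    have e2 : ∀ x : ℝ, Real.exp (2 * x) = Real.exp x ^ 2 := fun x => by
      rw [← Real.exp_nat_mul]; norm_num
    rw [jac_τ₄]
    simp only [Gtarget, Gsource₄, τ₄, e3, e2]
    generalize Real.exp p.1 = a
    generalize Real.exp p.2 = b
    generalize kConst = k at *
    ext i j
    fin_cases i <;> fin_cases j <;> simp [Matrix.mul_apply, Fin.sum_univ_two]
    · linear_combination (8 / 9 * (a ^ 3 + b ^ 3) * a ^ 2) * hk5
    · ring
    · ring
    · linear_combination (-(8 / 9 * (a ^ 3 + b ^ 3) * b ^ 2)) * hk5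
  · rw [jac_τ₄, Matrix.det_fin_two_of]
    have ha := Real.exp_pos p.1
    have hb := Real.exp_pos p.2
    have : 0 < 4 / 3 * kConst ^ 3 * (Real.exp p.1 + Real.exp p.2) * Real.exp p.1 * Real.exp p.2 := by
      positivity
    apply ne_of_lt
    linarith
  · simp only [τ₄]
    positivity
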